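/- Let b : ℝ → [0,∞) be absolutely continuous with b' integrable against φ, with lim_{x→±∞} b(x)φ(x) = 0 and ∫_ℝ b(x)φ(x) dx = 1, and let X be a random variable with density p(x) = b(x)φ(x). Then for every x with b(x) ≠ 0, the Stein kernel of X satisfies τ_X(x) = 1 + (∫_x^∞ b'(u) φ(u) du)/(b(x) φ(x)). Equivalently, ∫_x^∞ u b(u) φ(u) du = b(x)φ(x) + ∫_x^∞ b'(u) φ(u) du for all x. -/

import Mathlib

open MeasureTheory Filter

/-- The standard normal density. -/
noncomputable def gaussPdf (x : ℝ) : ℝ := Real.exp (-x ^ 2 / 2) / Real.sqrt (2 * Real.pi)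

theorem continuous_gaussPdf : Continuous gaussPdf := by
  unfold gaussPdf
  fun_prop

theorem gaussPdf_pos (x : ℝ) : 0 < gaussPdf x := by
  unfold gaussPdf
  positivity

theorem hasDerivAt_gaussPdf (x : ℝ) : HasDerivAt gaussPdf (-x * gaussPdf x) x := by
  have h : HasDerivAt (fun y : ℝ => -y ^ 2 / 2) (-x) x :=
    ((hasDerivAt_pow 2 x).fun_neg.div_const 2).congr_deriv (by norm_num; ring)
  refine (h.exp.div_const (Real.sqrt (2 * Real.pi))).congr_deriv ?_
  simp only [gaussPdf]
  ring

theorem hasDerivAt_mul_gaussPdf {b : ℝ → ℝ} {d x : ℝ} (h : HasDerivAt b d x) :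
    HasDerivAt (fun y => b y * gaussPdf y) (d * gaussPdf x - x * b x * gaussPdf x) x :=
  (h.mul (hasDerivAt_gaussPdf x)).congr_deriv (by ring)

/-- The first moment of the density `b φ` is finite on every right half-line. -/
theorem integrableOn_Ioi_id_mul_mul_gaussPdf {b b' : ℝ → ℝ} {l : ℝ}
    (hbnn : ∀ x, 0 ≤ b x) (hderiv : ∀ x, HasDerivAt b (b' x) x)
    (hint : Integrable (fun u => b' u * gaussPdf u))
    (htop : Tendsto (fun x => b x * gaussPdf x) atTop (nhds l)) (x : ℝ) :
    IntegrableOn (fun u => u * b u * gaussPdf u) (Set.Ioi x) := by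
  have hcont : Continuous (fun u => u * b u * gaussPdf u) :=
    (continuous_id.mul (continuous_iff_continuousAt.2 fun y => (hderiv y).continuousAt)).mul
      continuous_gaussPdf
  have hIoi : IntegrableOn (fun u => u * b u * gaussPdf u) (Set.Ioi 0) := by
    refine integrableOn_Ioi_of_intervalIntegral_norm_tendsto
      (b 0 * gaussPdf 0 - l + ∫ u in Set.Ioi 0, b' u * gaussPdf u) 0
      (fun i => hcont.integrableOn_Ioc) tendsto_id ?_
    have hlim := (tendsto_const_nhds (x := b 0 * gaussPdf 0)).sub htop |>.add
      (intervalIntegral_tendsto_integral_Ioi 0 hint.integrableOn tendsto_id)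
    refine hlim.congr' ?_
    filter_upwards [eventually_ge_atTop 0] with R hR
    have hnorm : ∫ u in (0 : ℝ)..R, ‖u * b u * gaussPdf u‖
        = ∫ u in (0 : ℝ)..R, u * b u * gaussPdf u := by
      refine intervalIntegral.integral_congr fun u hu => ?_
      rw [Set.uIcc_of_le hR] at hu
      exact Real.norm_of_nonneg
        (mul_nonneg (mul_nonneg hu.1 (hbnn u)) (gaussPdf_pos u).le)
    have hi := hcont.intervalIntegrable (μ := volume) 0 R
    have hFTC := intervalIntegral.integral_eq_sub_of_hasDerivAt
      (fun y _ => hasDerivAt_mul_gaussPdf (hderiv y))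
      (hint.intervalIntegrable (a := 0) (b := R) |>.sub hi)
    rw [intervalIntegral.integral_sub hint.intervalIntegrable hi] at hFTC
    simp only [id] at *
    rw [hnorm]
    linarith
  refine ((hcont.integrableOn_Ioc (a := x) (b := 0)).union hIoi).mono_set fun y hy => ?_
  rcases le_or_gt y 0 with h | h
  · exact Or.inl ⟨hy, h⟩
  · exact Or.inr h

/-- Let `b ≥ 0` be absolutely continuous with derivative `b'` integrable
against `φ`, `b(x)φ(x) → 0` as `x → ±∞` and `∫ b φ = 1`, and let `X` have density
`p = b φ`.  Then `∫_x^∞ u b(u) φ(u) du = b(x)φ(x) + ∫_x^∞ b'(u) φ(u) du` for all `x`;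
equivalently, wherever `b(x) ≠ 0`, the Stein kernel satisfies
`τ_X(x) = 1 + (∫_x^∞ b'(u) φ(u) du)/(b(x) φ(x))`. -/
theorem stmt10 (b b' : ℝ → ℝ)
    (hbnn : ∀ x, 0 ≤ b x)
    (hderiv : ∀ x, HasDerivAt b (b' x) x)
    (hint : Integrable (fun u => b' u * gaussPdf u))
    (htop : Tendsto (fun x => b x * gaussPdf x) atTop (nhds 0))
    (hbot : Tendsto (fun x => b x * gaussPdf x) atBot (nhds 0))
    (hnorm : ∫ x, b x * gaussPdf x = 1) :
    (∀ x, ∫ u in Set.Ioi x, u * b u * gaussPdf u =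
        b x * gaussPdf x + ∫ u in Set.Ioi x, b' u * gaussPdf u) ∧
    (∀ x, b x ≠ 0 →
      (∫ u in Set.Ioi x, u * b u * gaussPdf u) / (b x * gaussPdf x) =
        1 + (∫ u in Set.Ioi x, b' u * gaussPdf u) / (b x * gaussPdf x)) := by
  have hmain : ∀ x, ∫ u in Set.Ioi x, u * b u * gaussPdf u =
      b x * gaussPdf x + ∫ u in Set.Ioi x, b' u * gaussPdf u := by
    intro x
    have hi := integrableOn_Ioi_id_mul_mul_gaussPdf hbnn hderiv hint htop x
    have hFTC := integral_Ioi_of_hasDerivAt_of_tendsto'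
      (fun y (_ : y ∈ Set.Ici x) => hasDerivAt_mul_gaussPdf (hderiv y))
      (hint.integrableOn.sub hi) htop
    rw [integral_sub hint.integrableOn hi] at hFTC
    linarith
  refine ⟨hmain, fun x hx => ?_⟩
  rw [hmain x, add_div, div_self (mul_ne_zero hx (gaussPdf_pos x).ne')]
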